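/- Let G be a finite simple graph all of whose internal vertices are of type 0 or type 1, and let n_0 be the maximum number of vertices in a connected component of G_0 (with n_0 = 0 if G_0 has no vertices). Then μ_α(G) ≤ 1 if and only if μ_α(G_0) ≤ 1 and for every independent set I of G contained in V(G_1) with |I| ≤ 2·n_0 it holds that α(G_0) − i(G_0 − N(I)) ≤ 1, where N(I) is the neighborhood of I in G and G_0 − N(I) is the subgraph of G induced on V(G_0) ∖ N(I). -/

import Mathlib

/-- `s` is an independent set in `G`: no two vertices of `s` are adjacent. -/
def IndepSet {V : Type*} (G : SimpleGraph V) (s : Set V) : Prop :=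
  ∀ ⦃a⦄, a ∈ s → ∀ ⦃b⦄, b ∈ s → ¬ G.Adj a b

/-- `s` is a maximal independent set in `G`. -/
def MaxIndepSet {V : Type*} (G : SimpleGraph V) (s : Set V) : Prop :=
  IndepSet G s ∧ ∀ t : Set V, IndepSet G t → s ⊆ t → s = t

/-- `α(G)`: the maximum size of an independent set of `G`. -/
noncomputable def alphaNum {V : Type*} (G : SimpleGraph V) : ℕ :=
  sSup {n | ∃ s : Set V, IndepSet G s ∧ s.ncard = n}

/-- `i(G)`: the minimum size of a maximal independent set of `G`. -/
noncomputable def iNum {V : Type*} (G : SimpleGraph V) : ℕ :=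
  sInf {n | ∃ s : Set V, MaxIndepSet G s ∧ s.ncard = n}

/-- The independence gap `μ_α(G) = α(G) - i(G)`. -/
noncomputable def indepGap {V : Type*} (G : SimpleGraph V) : ℕ :=
  alphaNum G - iNum G

/-- `G` is well-covered: all maximal independent sets have the same size. -/
def WellCovered {V : Type*} (G : SimpleGraph V) : Prop :=
  alphaNum G = iNum G

/-- `G` is almost well-covered: its independence gap equals 1. -/
def AlmostWellCovered {V : Type*} (G : SimpleGraph V) : Prop :=
  indepGap G = 1

/-- The (open) neighborhood `N(I)` of a set of vertices `I`. -/
def nbhd {V : Type*} (G : SimpleGraph V) (I : Set V) : Set V :=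
  {v | ∃ u ∈ I, G.Adj u v}

/-- `U(G)`: the set of vertices whose connected component induces a complete graph. -/
def completeU {V : Type*} (G : SimpleGraph V) : Set V :=
  {u | G.IsClique (G.connectedComponentMk u).supp}

/-- A leaf: a vertex of the graph `G - U(G)` having degree 1 there. -/
def IsLeaf {V : Type*} (G : SimpleGraph V) (v : V) : Prop :=
  v ∉ completeU G ∧ {u | u ∉ completeU G ∧ G.Adj v u}.ncard = 1

/-- An internal vertex: a vertex of `G - U(G)` that is not a leaf. -/
def IsInternal {V : Type*} (G : SimpleGraph V) (v : V) : Prop :=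
  v ∉ completeU G ∧ ¬ IsLeaf G v

/-- A vertex has type `k` if it is an internal vertex adjacent to exactly `k` leaves;
in addition every vertex of `U(G)` has type `0`. -/
def HasType {V : Type*} (G : SimpleGraph V) (v : V) (k : ℕ) : Prop :=
  (IsInternal G v ∧ {u | IsLeaf G u ∧ G.Adj v u}.ncard = k) ∨ (v ∈ completeU G ∧ k = 0)

/-- The set of vertices of type `k`; `G_k` is the subgraph induced by this set. -/
def typeSet {V : Type*} (G : SimpleGraph V) (k : ℕ) : Set V :=
  {v | HasType G v k}

/-- The maximum number of vertices in a connected component of `G`. -/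
noncomputable def maxCompCard {V : Type*} (G : SimpleGraph V) : ℕ :=
  sSup {n | ∃ c : G.ConnectedComponent, c.supp.ncard = n}

/-- `G` has no cycle of length `n`. -/
def NoCycleOfLength {V : Type*} (G : SimpleGraph V) (n : ℕ) : Prop :=
  ∀ (v : V) (w : G.Walk v v), w.IsCycle → w.length ≠ n

/-- `G` has girth at least 6: no cycle of length 3, 4, or 5. -/
def GirthAtLeastSix {V : Type*} (G : SimpleGraph V) : Prop :=
  NoCycleOfLength G 3 ∧ NoCycleOfLength G 4 ∧ NoCycleOfLength G 5

/-- A pendant edge: an edge incident with a vertex of degree 1. -/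
def pendantEdges {V : Type*} (G : SimpleGraph V) : Set (Sym2 V) :=
  {e | e ∈ G.edgeSet ∧ ∃ v ∈ e, (G.neighborSet v).ncard = 1}

/-- The pendant edges of `G` are pairwise disjoint and cover every vertex of `G`. -/
def PendantPerfectMatching {V : Type*} (G : SimpleGraph V) : Prop :=
  (∀ e ∈ pendantEdges G, ∀ f ∈ pendantEdges G, e ≠ f → ∀ v : V, v ∈ e → v ∉ f) ∧
  (∀ v : V, ∃ e ∈ pendantEdges G, v ∈ e)

/-- `s` is a maximal independent set of the subgraph of `G` induced by `X`. -/
def MaxIndepIn {V : Type*} (G : SimpleGraph V) (X s : Set V) : Prop :=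
  s ⊆ X ∧ IndepSet G s ∧ ∀ v ∈ X, v ∉ s → ∃ u ∈ s, G.Adj u v

section Basic

variable {V : Type*} {G : SimpleGraph V}

lemma nbhd_empty (G : SimpleGraph V) : nbhd G ∅ = ∅ := by
  ext v
  exact ⟨fun ⟨_, hu, _⟩ => hu.elim, fun hv => hv.elim⟩

lemma IndepSet.mono {s t : Set V} (ht : IndepSet G t) (h : s ⊆ t) : IndepSet G s :=
  fun _ ha _ hb => ht (h ha) (h hb)

lemma IndepSet.union {s t : Set V} (hs : IndepSet G s) (ht : IndepSet G t)
    (hst : ∀ a ∈ s, ∀ b ∈ t, ¬ G.Adj a b) : IndepSet G (s ∪ t) := by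
  rintro a (ha | ha) b (hb | hb)
  · exact hs ha hb
  · exact hst a ha b hb
  · exact fun h => hst b hb a ha h.symm
  · exact ht ha hb

lemma maxIndepSet_iff {s : Set V} : MaxIndepSet G s ↔ MaxIndepIn G Set.univ s := by
  constructor
  · rintro ⟨hs, hmax⟩
    refine ⟨Set.subset_univ _, hs, fun v _ hv => ?_⟩
    by_contra! hno
    have hins : IndepSet G (insert v s) := by
      rintro a (rfl | ha) b (rfl | hb) hab
      · exact G.loopless.irrefl _ hab
      · exact hno b hb hab.symm
      · exact hno a ha hab
      · exact hs ha hb hab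
    exact hv (hmax _ hins (Set.subset_insert v s) ▸ Set.mem_insert v s)
  · rintro ⟨-, hs, hmax⟩
    refine ⟨hs, fun t ht hst => hst.antisymm fun v hv => ?_⟩
    by_contra hvs
    obtain ⟨u, hu, huv⟩ := hmax v trivial hvs
    exact ht (hst hu) hv huv

lemma indepSet_induce {X : Set V} {s : Set X} :
    IndepSet (G.induce X) s ↔ IndepSet G (Subtype.val '' s) := by
  simp [IndepSet]

lemma maxIndepSet_induce {X : Set V} {s : Set X} :
    MaxIndepSet (G.induce X) s ↔ MaxIndepIn G X (Subtype.val '' s) := by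
  rw [maxIndepSet_iff, MaxIndepIn, MaxIndepIn, indepSet_induce]
  simp +contextual

lemma MaxIndepSet.iNum_le_ncard {s : Set V} (hs : MaxIndepSet G s) : iNum G ≤ s.ncard :=
  Nat.sInf_le ⟨s, hs, rfl⟩

lemma MaxIndepIn.iNum_induce_le_ncard {X s : Set V} (hs : MaxIndepIn G X s) :
    iNum (G.induce X) ≤ s.ncard := by
  have hX := hs.1
  lift s to Set X using hX
  rw [Set.ncard_image_of_injective _ Subtype.val_injective]
  exact (maxIndepSet_induce.2 hs).iNum_le_ncard

variable [Finite V]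

lemma IndepSet.ncard_le_alphaNum {s : Set V} (hs : IndepSet G s) : s.ncard ≤ alphaNum G :=
  le_csSup ⟨Nat.card V, by rintro _ ⟨t, -, rfl⟩; exact Set.ncard_le_card t⟩ ⟨s, hs, rfl⟩

lemma exists_indepSet_ncard_eq_alphaNum (G : SimpleGraph V) :
    ∃ s : Set V, IndepSet G s ∧ s.ncard = alphaNum G :=
  Nat.sSup_mem (s := {n | ∃ s : Set V, IndepSet G s ∧ s.ncard = n})
    ⟨_, ∅, fun _ ha => ha.elim, rfl⟩
    ⟨Nat.card V, by rintro _ ⟨t, -, rfl⟩; exact Set.ncard_le_card t⟩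

lemma exists_maxIndepSet (G : SimpleGraph V) : ∃ s : Set V, MaxIndepSet G s := by
  obtain ⟨s, hs, hcard⟩ := exists_indepSet_ncard_eq_alphaNum G
  exact ⟨s, hs, fun t ht hst =>
    Set.eq_of_subset_of_ncard_le hst (hcard ▸ ht.ncard_le_alphaNum) t.toFinite⟩

lemma exists_maxIndepSet_ncard_eq_iNum (G : SimpleGraph V) :
    ∃ s : Set V, MaxIndepSet G s ∧ s.ncard = iNum G :=
  Nat.sInf_mem (s := {n | ∃ s : Set V, MaxIndepSet G s ∧ s.ncard = n})
    (let ⟨s, hs⟩ := exists_maxIndepSet G; ⟨_, s, hs, rfl⟩)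

lemma IndepSet.ncard_le_alphaNum_induce {X s : Set V} (hs : IndepSet G s) (hX : s ⊆ X) :
    s.ncard ≤ alphaNum (G.induce X) := by
  lift s to Set X using hX
  rw [Set.ncard_image_of_injective _ Subtype.val_injective]
  exact (indepSet_induce.2 hs).ncard_le_alphaNum

lemma exists_indepSet_ncard_eq_alphaNum_induce (G : SimpleGraph V) (X : Set V) :
    ∃ s ⊆ X, IndepSet G s ∧ s.ncard = alphaNum (G.induce X) := by
  obtain ⟨s, hs, hcard⟩ := exists_indepSet_ncard_eq_alphaNum (G.induce X)
  exact ⟨Subtype.val '' s, by simp, indepSet_induce.1 hs,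
    by rw [Set.ncard_image_of_injective _ Subtype.val_injective, hcard]⟩

lemma exists_maxIndepIn_ncard_eq_iNum (G : SimpleGraph V) (X : Set V) :
    ∃ s, MaxIndepIn G X s ∧ s.ncard = iNum (G.induce X) := by
  obtain ⟨s, hs, hcard⟩ := exists_maxIndepSet_ncard_eq_iNum (G.induce X)
  exact ⟨Subtype.val '' s, maxIndepSet_induce.1 hs,
    by rw [Set.ncard_image_of_injective _ Subtype.val_injective, hcard]⟩

end Basic

/-- `f` matches `B` with the complement of `A ∪ B`, every `f v` being a pendant vertex attached
to `v`, where `A` and `B` are disjoint. -/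
structure PendantPartition {V : Type*} (G : SimpleGraph V) (A B : Set V) (f : V → V) : Prop where
  disjoint : Disjoint A B
  cover : ∀ v, v ∈ A ∨ v ∈ B ∨ v ∈ f '' B
  notMem_left : ∀ v ∈ B, f v ∉ A
  notMem_right : ∀ v ∈ B, f v ∉ B
  adj_iff : ∀ v ∈ B, ∀ u, G.Adj (f v) u ↔ u = v

namespace PendantPartition

variable {V : Type*} {G : SimpleGraph V} {A B : Set V} {f : V → V}

lemma injOn (h : PendantPartition G A B f) : Set.InjOn f B := by
  intro v hv w hw hvw
  rw [← h.adj_iff w hw, ← hvw, h.adj_iff v hv]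

lemma ncard_union [Finite V] (h : PendantPartition G A B f) {s I : Set V} (hs : s ⊆ A)
    (hI : I ⊆ B) : (s ∪ (I ∪ f '' (B \ I))).ncard = s.ncard + B.ncard := by
  have hdisj : Disjoint I (f '' (B \ I)) := by
    rw [Set.disjoint_left]
    rintro _ hv ⟨w, hw, rfl⟩
    exact h.notMem_right w hw.1 (hI hv)
  have hdisj' : Disjoint s (I ∪ f '' (B \ I)) := by
    rw [Set.disjoint_left]
    rintro v hv (hv' | ⟨w, hw, rfl⟩)
    · exact Set.disjoint_left.1 h.disjoint (hs hv) (hI hv')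
    · exact h.notMem_left w hw.1 (hs hv)
  rw [Set.ncard_union_eq hdisj', Set.ncard_union_eq hdisj,
    (h.injOn.mono Set.sdiff_subset).ncard_image, add_comm I.ncard,
    Set.ncard_sdiff_add_ncard_of_subset hI]

lemma indepSet_union (h : PendantPartition G A B f) {s I : Set V} (hs : s ⊆ A)
    (hsi : IndepSet G s) (hIi : IndepSet G I) (hsI : Disjoint s (nbhd G I)) :
    IndepSet G (s ∪ (I ∪ f '' (B \ I))) := by
  refine hsi.union (hIi.union ?_ ?_) ?_
  · rintro _ ⟨v, hv, rfl⟩ _ ⟨w, hw, rfl⟩ hvw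
    rw [h.adj_iff v hv.1] at hvw
    exact h.notMem_right w hw.1 (hvw ▸ hv.1)
  · rintro a ha _ ⟨w, hw, rfl⟩ haw
    rw [G.adj_comm, h.adj_iff w hw.1] at haw
    exact hw.2 (haw ▸ ha)
  · rintro a ha _ (hb | ⟨w, hw, rfl⟩) hab
    · exact Set.disjoint_left.1 hsI ha ⟨_, hb, hab.symm⟩
    · rw [G.adj_comm, h.adj_iff w hw.1] at hab
      exact Set.disjoint_left.1 h.disjoint (hs ha) (hab ▸ hw.1)

lemma maxIndepSet_union (h : PendantPartition G A B f) {s I : Set V} (hIi : IndepSet G I)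
    (hs : MaxIndepIn G (A \ nbhd G I) s) :
    MaxIndepSet G (s ∪ (I ∪ f '' (B \ I))) := by
  obtain ⟨hsA, hsi, hmax⟩ := hs
  refine maxIndepSet_iff.2 ⟨Set.subset_univ _, h.indepSet_union (fun v hv => (hsA hv).1) hsi hIi
    (Set.disjoint_left.2 fun v hv => (hsA hv).2), fun v _ hv => ?_⟩
  rcases h.cover v with hvA | hvB | ⟨w, hw, rfl⟩
  · by_cases hvI : v ∈ nbhd G I
    · obtain ⟨u, hu, huv⟩ := hvI
      exact ⟨u, .inr (.inl hu), huv⟩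
    · obtain ⟨u, hu, huv⟩ := hmax v ⟨hvA, hvI⟩ fun hvs => hv (.inl hvs)
      exact ⟨u, .inl hu, huv⟩
  · exact ⟨f v, .inr (.inr ⟨v, ⟨hvB, fun hvI => hv (.inr (.inl hvI))⟩, rfl⟩),
      (h.adj_iff v hvB v).2 rfl⟩
  · have hwI : w ∈ I := by
      by_contra hwI
      exact hv (.inr (.inr ⟨w, ⟨hw, hwI⟩, rfl⟩))
    exact ⟨w, .inr (.inl hwI), ((h.adj_iff w hw w).2 rfl).symm⟩

lemma subset_union_of_indepSet (h : PendantPartition G A B f) {s : Set V} (hs : IndepSet G s) :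
    s ⊆ (s ∩ A) ∪ ((s ∩ B) ∪ f '' (B \ (s ∩ B))) := by
  intro v hv
  rcases h.cover v with hvA | hvB | ⟨w, hw, rfl⟩
  · exact .inl ⟨hv, hvA⟩
  · exact .inr (.inl ⟨hv, hvB⟩)
  · exact .inr (.inr ⟨w, ⟨hw, fun hws => hs hv hws.1 ((h.adj_iff w hw w).2 rfl)⟩, rfl⟩)

lemma maxIndepIn_inter (h : PendantPartition G A B f) {s : Set V} (hs : MaxIndepSet G s) :
    MaxIndepIn G (A \ nbhd G (s ∩ B)) (s ∩ A) := by
  obtain ⟨-, hsi, hmax⟩ := maxIndepSet_iff.1 hs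
  refine ⟨fun v hv => ⟨hv.2, ?_⟩, hsi.mono Set.inter_subset_left, fun v hv hvs => ?_⟩
  · rintro ⟨u, hu, huv⟩
    exact hsi hu.1 hv.1 huv
  · obtain ⟨u, hu, huv⟩ := hmax v trivial fun h' => hvs ⟨h', hv.1⟩
    rcases h.cover u with huA | huB | ⟨w, hw, rfl⟩
    · exact ⟨u, ⟨hu, huA⟩, huv⟩
    · exact (hv.2 ⟨u, ⟨hu, huB⟩, huv⟩).elim
    · rw [h.adj_iff w hw] at huv
      exact (Set.disjoint_left.1 h.disjoint hv.1 (huv ▸ hw)).elim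

lemma eq_union_of_maxIndepSet (h : PendantPartition G A B f) {s : Set V} (hs : MaxIndepSet G s) :
    s = (s ∩ A) ∪ ((s ∩ B) ∪ f '' (B \ (s ∩ B))) :=
  hs.2 _ (h.maxIndepSet_union (hs.1.mono Set.inter_subset_left)
    (h.maxIndepIn_inter hs)).1 (h.subset_union_of_indepSet hs.1)

variable [Finite V]

lemma alphaNum_eq (h : PendantPartition G A B f) :
    alphaNum G = alphaNum (G.induce A) + B.ncard := by
  apply le_antisymm
  · obtain ⟨s, hs, hcard⟩ := exists_indepSet_ncard_eq_alphaNum G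
    rw [← hcard]
    refine (Set.ncard_le_ncard (h.subset_union_of_indepSet hs)).trans ?_
    rw [h.ncard_union Set.inter_subset_right Set.inter_subset_right]
    gcongr
    exact (hs.mono Set.inter_subset_left).ncard_le_alphaNum_induce Set.inter_subset_right
  · obtain ⟨s, hsA, hs, hcard⟩ := exists_indepSet_ncard_eq_alphaNum_induce G A
    rw [← hcard, ← h.ncard_union hsA (Set.empty_subset B)]
    exact (h.indepSet_union hsA hs (fun _ ha => ha.elim)
      (by simp [nbhd_empty])).ncard_le_alphaNum

lemma indepGap_le_iff (h : PendantPartition G A B f) (k : ℕ) :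
    indepGap G ≤ k ↔ ∀ I : Set V, IndepSet G I → I ⊆ B →
      alphaNum (G.induce A) - iNum (G.induce (A \ nbhd G I)) ≤ k := by
  rw [indepGap, h.alphaNum_eq]
  constructor
  · intro hgap I hI hIB
    obtain ⟨s, hs, hcard⟩ := exists_maxIndepIn_ncard_eq_iNum G (A \ nbhd G I)
    have hle := (h.maxIndepSet_union hI hs).iNum_le_ncard
    rw [h.ncard_union (hs.1.trans Set.sdiff_subset) hIB] at hle
    omega
  · intro hgap
    obtain ⟨s, hs, hcard⟩ := exists_maxIndepSet_ncard_eq_iNum G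
    have hle := (h.maxIndepIn_inter hs).iNum_induce_le_ncard
    have hI := hgap _ (hs.1.mono Set.inter_subset_left) (Set.inter_subset_right (s := s))
    rw [h.eq_union_of_maxIndepSet hs,
      h.ncard_union Set.inter_subset_right Set.inter_subset_right] at hcard
    omega

end PendantPartition

section Localization

/-- If one finite sum exceeds another by at least two, this is already witnessed by at most two
indices. -/
lemma exists_card_le_two_sum_add_two_le {ι : Type*} (t : Finset ι) (a s : ι → ℕ)
    (h : ∑ i ∈ t, s i + 2 ≤ ∑ i ∈ t, a i) :
    ∃ T : Finset ι, T.card ≤ 2 ∧ ∑ i ∈ T, s i + 2 ≤ ∑ i ∈ T, a i := by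
  classical
  obtain ⟨i, hi, hai⟩ : ∃ i ∈ t, s i < a i :=
    Finset.exists_lt_of_sum_lt (by omega)
  by_cases hai' : s i + 2 ≤ a i
  · exact ⟨{i}, by simp, by simpa using hai'⟩
  have hs := Finset.add_sum_erase t s hi
  have ha := Finset.add_sum_erase t a hi
  obtain ⟨j, hj, haj⟩ : ∃ j ∈ t.erase i, s j < a j :=
    Finset.exists_lt_of_sum_lt (by omega)
  have hij : i ≠ j := (Finset.ne_of_mem_erase hj).symm
  refine ⟨{i, j}, Finset.card_le_two, ?_⟩
  rw [Finset.sum_pair hij, Finset.sum_pair hij]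
  omega

lemma ncard_preimage_eq_sum {V ι : Type*} [Finite V] (c : V → ι) (T : Finset ι)
    (s : Set V) : (s ∩ c ⁻¹' T).ncard = ∑ i ∈ T, (s ∩ c ⁻¹' {i}).ncard := by
  classical
  induction T using Finset.induction_on with
  | empty => simp
  | insert i T hi ih =>
    rw [Finset.sum_insert hi, ← ih, ← Set.ncard_union_eq]
    · congr 1
      ext v
      simp
      tauto
    · rw [Set.disjoint_left]
      rintro v ⟨-, hv⟩ ⟨-, hv'⟩
      simp only [Set.mem_preimage, Set.mem_singleton_iff, Finset.mem_coe] at hv hv'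
      exact hi (hv ▸ hv')

variable {V : Type*} [Finite V] {G : SimpleGraph V}

/-- Every set of vertices dominated by `I` is dominated by a subset of `I` that is no larger. -/
lemma exists_subset_ncard_le_subset_nbhd {I D : Set V} (hD : D ⊆ nbhd G I) :
    ∃ J ⊆ I, J.ncard ≤ D.ncard ∧ D ⊆ nbhd G J := by
  have hD' : ∀ v ∈ D, ∃ u ∈ I, G.Adj u v := fun v hv => hD hv
  choose! g hgI hg using hD'
  exact ⟨g '' D, by rintro _ ⟨v, hv, rfl⟩; exact hgI v hv, Set.ncard_image_le,
    fun v hv => ⟨g v, ⟨v, hv, rfl⟩, hg v hv⟩⟩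

lemma ncard_supp_le_maxCompCard (c : G.ConnectedComponent) :
    c.supp.ncard ≤ maxCompCard G :=
  le_csSup ⟨Nat.card V, by rintro _ ⟨c, rfl⟩; exact Set.ncard_le_card _⟩ ⟨c, rfl⟩

/-- A union of components of `G.induce A` on which the maximal independent set `s` is deficient
allows to replace `I` by a subset of bounded size. -/
lemma exists_small_subset_of_deficient {A I s a K : Set V}
    (hK : K ⊆ A) (hKadj : ∀ u ∈ A, ∀ v ∈ A, G.Adj u v → u ∈ K → v ∈ K)
    (hs : MaxIndepIn G (A \ nbhd G I) s) (haA : a ⊆ A) (ha : IndepSet G a)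
    (hdef : (s ∩ K).ncard + 2 ≤ (a ∩ K).ncard) :
    ∃ J ⊆ I, J.ncard ≤ K.ncard ∧
      iNum (G.induce (A \ nbhd G J)) + 2 ≤ alphaNum (G.induce A) := by
  obtain ⟨J, hJI, hJcard, hJ⟩ :=
    exists_subset_ncard_le_subset_nbhd (G := G) (I := I) (D := K ∩ nbhd G I) Set.inter_subset_right
  obtain ⟨r, ⟨hrsub, hr, hrmax⟩, -⟩ :=
    exists_maxIndepIn_ncard_eq_iNum G ((A \ nbhd G J) \ K)
  have hrA : r ⊆ A := fun v hv => (hrsub hv).1.1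
  have hsA : s ⊆ A := fun v hv => (hs.1 hv).1
  have hcross : ∀ x ∈ K, ∀ y ∈ r, ¬ G.Adj x y := fun x hx y hy hxy =>
    (hrsub hy).2 (hKadj x (hK hx) y (hrA hy) hxy hx)
  have hJmono : nbhd G J ⊆ nbhd G I := fun v ⟨u, hu, huv⟩ => ⟨u, hJI hu, huv⟩
  have hmax : MaxIndepIn G (A \ nbhd G J) ((s ∩ K) ∪ r) := by
    refine ⟨Set.union_subset (fun v hv => ⟨hsA hv.1, fun h' => (hs.1 hv.1).2 (hJmono h')⟩)
      (fun v hv => (hrsub hv).1), (hs.2.1.mono Set.inter_subset_left).union hr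
        fun x hx y hy => hcross x hx.2 y hy, fun v hv hvn => ?_⟩
    by_cases hvK : v ∈ K
    · obtain ⟨u, hu, huv⟩ := hs.2.2 v ⟨hv.1, fun h' => hv.2 (hJ ⟨hvK, h'⟩)⟩
        fun h' => hvn (.inl ⟨h', hvK⟩)
      exact ⟨u, .inl ⟨hu, hKadj v hv.1 u (hsA hu) huv.symm hvK⟩, huv⟩
    · obtain ⟨u, hu, huv⟩ := hrmax v ⟨hv, hvK⟩ fun h' => hvn (.inr h')
      exact ⟨u, .inr hu, huv⟩
  have hexch : ((a ∩ K) ∪ r).ncard ≤ alphaNum (G.induce A) :=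
    ((ha.mono Set.inter_subset_left).union hr
      fun x hx y hy => hcross x hx.2 y hy).ncard_le_alphaNum_induce
        (Set.union_subset (fun v hv => haA hv.1) hrA)
  rw [Set.ncard_union_eq (Set.disjoint_left.2 fun v hv hvr => (hrsub hvr).2 hv.2)] at hexch
  have hle := hmax.iNum_induce_le_ncard.trans (Set.ncard_union_le _ _)
  exact ⟨J, hJI, hJcard.trans (Set.ncard_le_ncard Set.inter_subset_left), by omega⟩

lemma exists_ncard_le_of_iNum_add_two_le {A I : Set V}
    (h : iNum (G.induce (A \ nbhd G I)) + 2 ≤ alphaNum (G.induce A)) :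
    ∃ J ⊆ I, J.ncard ≤ 2 * maxCompCard (G.induce A) ∧
      iNum (G.induce (A \ nbhd G J)) + 2 ≤ alphaNum (G.induce A) := by
  classical
  obtain ⟨s, hs, hscard⟩ := exists_maxIndepIn_ncard_eq_iNum G (A \ nbhd G I)
  obtain ⟨a, haA, ha, hacard⟩ := exists_indepSet_ncard_eq_alphaNum_induce G A
  have hsA : s ⊆ A := fun v hv => (hs.1 hv).1
  have : Fintype (G.induce A).ConnectedComponent := Fintype.ofFinite _
  set c : A → (G.induce A).ConnectedComponent := (G.induce A).connectedComponentMk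
  have hval : ∀ {x : Set V} (T : Finset (G.induce A).ConnectedComponent),
      (x ∩ Subtype.val '' (c ⁻¹' T)).ncard =
        ∑ i ∈ T, ((Subtype.val ⁻¹' x : Set A) ∩ c ⁻¹' {i}).ncard := by
    intro x T
    rw [← ncard_preimage_eq_sum, Set.inter_comm, ← Set.image_inter_preimage,
      Set.ncard_image_of_injective _ Subtype.val_injective, Set.inter_comm]
  have huniv : ∀ {x : Set V}, x ⊆ A →
      x.ncard = ∑ i, ((Subtype.val ⁻¹' x : Set A) ∩ c ⁻¹' {i}).ncard := by
    intro x hx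
    rw [← hval]
    simpa using (congrArg Set.ncard (Set.inter_eq_left.2 hx)).symm
  obtain ⟨T, hT, hdef⟩ := exists_card_le_two_sum_add_two_le Finset.univ
    (fun i => ((Subtype.val ⁻¹' a : Set A) ∩ c ⁻¹' {i}).ncard)
    (fun i => ((Subtype.val ⁻¹' s : Set A) ∩ c ⁻¹' {i}).ncard)
    (by rw [← huniv haA, ← huniv hsA]; omega)
  rw [← hval, ← hval] at hdef
  have hclosed : ∀ u ∈ A, ∀ v ∈ A, G.Adj u v → u ∈ Subtype.val '' (c ⁻¹' T) →
      v ∈ Subtype.val '' (c ⁻¹' T) := by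
    rintro u hu v hv huv ⟨u', hu', rfl⟩
    refine ⟨⟨v, hv⟩, ?_, rfl⟩
    have hadj : (G.induce A).Adj u' ⟨v, hv⟩ := huv
    have hc : c u' = c ⟨v, hv⟩ := SimpleGraph.ConnectedComponent.sound hadj.reachable
    simpa [← hc] using hu'
  obtain ⟨J, hJI, hJcard, hJ⟩ :=
    exists_small_subset_of_deficient (by simp) hclosed hs haA ha hdef
  refine ⟨J, hJI, hJcard.trans ?_, hJ⟩
  have hK := hval (x := Set.univ) T
  rw [Set.univ_inter] at hK
  rw [hK]
  refine (Finset.sum_le_card_nsmul T _ (maxCompCard (G.induce A)) fun i _ => ?_).trans ?_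
  · exact (Set.ncard_le_ncard Set.inter_subset_right).trans (ncard_supp_le_maxCompCard i)
  · rw [smul_eq_mul]
    gcongr

end Localization

section Types

variable {V : Type*} {G : SimpleGraph V}

lemma mem_completeU_of_adj {u v : V} (huv : G.Adj u v) (hu : u ∈ completeU G) :
    v ∈ completeU G := by
  have hc : G.connectedComponentMk u = G.connectedComponentMk v :=
    SimpleGraph.ConnectedComponent.sound huv.reachable
  rw [completeU, Set.mem_ofPred_eq, ← hc]
  exact hu

lemma IsLeaf.exists_adj_iff {w : V} (hw : IsLeaf G w) : ∃ v, ∀ u, G.Adj w u ↔ u = v := by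
  obtain ⟨v, hv⟩ := Set.ncard_eq_one.1 hw.2
  refine ⟨v, fun u => ⟨fun h => ?_, ?_⟩⟩
  · have hu : u ∈ ({v} : Set V) :=
      hv ▸ ⟨fun hu => hw.1 (mem_completeU_of_adj h.symm hu), h⟩
    exact hu
  · rintro rfl
    exact (hv.symm ▸ Set.mem_singleton u : u ∈ {u | u ∉ completeU G ∧ G.Adj w u}).2

lemma not_adj_of_isLeaf_of_isLeaf {w v : V} (hw : IsLeaf G w) (hv : IsLeaf G v) :
    ¬ G.Adj w v := by
  intro hwv
  obtain ⟨w', hw'⟩ := hw.exists_adj_iff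
  obtain ⟨v', hv'⟩ := hv.exists_adj_iff
  obtain rfl := (hw' v).1 hwv
  obtain rfl := (hv' w).1 hwv.symm
  have hcomp : ∀ x ∈ (G.connectedComponentMk w).supp, x = w ∨ x = v := by
    intro x hx
    have hreach : G.Reachable w x := (SimpleGraph.ConnectedComponent.exact hx).symm
    rw [SimpleGraph.reachable_iff_reflTransGen] at hreach
    induction hreach with
    | refl => exact .inl rfl
    | @tail y z hwy hyz ih =>
      rcases ih (SimpleGraph.ConnectedComponent.sound
        ((SimpleGraph.reachable_iff_reflTransGen w y).2 hwy).symm) with rfl | rfl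
      · exact .inr ((hw' z).1 hyz)
      · exact .inl ((hv' z).1 hyz)
  refine hw.1 fun x hx y hy hxy => ?_
  rcases hcomp x hx with rfl | rfl <;> rcases hcomp y hy with rfl | rfl
  · exact (hxy rfl).elim
  · exact hwv
  · exact hwv.symm
  · exact (hxy rfl).elim

lemma not_isLeaf_of_hasType {v : V} {k : ℕ} (hv : HasType G v k) : ¬ IsLeaf G v := by
  rcases hv with ⟨hv, -⟩ | ⟨hv, -⟩
  · exact hv.2
  · exact fun hl => hl.1 hv

lemma exists_pendantPartition [Finite V]
    (htypes : ∀ v : V, IsInternal G v → HasType G v 0 ∨ HasType G v 1) :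
    ∃ f : V → V, PendantPartition G (typeSet G 0) (typeSet G 1) f := by
  have hone : ∀ v ∈ typeSet G 1, ∃ w, {u | IsLeaf G u ∧ G.Adj v u} = {w} := by
    rintro v (⟨-, hv⟩ | ⟨-, hv⟩)
    · exact Set.ncard_eq_one.1 hv
    · exact absurd hv one_ne_zero
  choose! f hf using hone
  have hmem : ∀ v ∈ typeSet G 1, IsLeaf G (f v) ∧ G.Adj v (f v) := fun v hv =>
    (hf v hv ▸ Set.mem_singleton (f v) : f v ∈ {u | IsLeaf G u ∧ G.Adj v u})
  refine ⟨f, ?_, fun v => ?_, fun v hv h => not_isLeaf_of_hasType h (hmem v hv).1,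
    fun v hv h => not_isLeaf_of_hasType h (hmem v hv).1, fun v hv u => ?_⟩
  · rw [Set.disjoint_left]
    rintro v (⟨-, h0⟩ | ⟨hU, -⟩) (⟨hi, h1⟩ | ⟨-, h1⟩)
    · omega
    · omega
    · exact hi.1 hU
    · omega
  · by_cases hU : v ∈ completeU G
    · exact .inl (.inr ⟨hU, rfl⟩)
    by_cases hl : IsLeaf G v
    · obtain ⟨w, hw⟩ := hl.exists_adj_iff
      have hvw := (hw w).2 rfl
      have hwi : IsInternal G w := ⟨fun h => hU (mem_completeU_of_adj hvw.symm h),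
        fun h => not_adj_of_isLeaf_of_isLeaf hl h hvw⟩
      have hvmem : v ∈ {u | IsLeaf G u ∧ G.Adj w u} := ⟨hl, hvw.symm⟩
      rcases htypes w hwi with (⟨-, h0⟩ | ⟨hwU, -⟩) | h1
      · rw [Set.ncard_eq_zero] at h0
        exact (Set.notMem_empty v (h0 ▸ hvmem)).elim
      · exact (hwi.1 hwU).elim
      · rw [hf w h1] at hvmem
        exact .inr (.inr ⟨w, h1, hvmem.symm⟩)
    · exact (htypes v ⟨hU, hl⟩).imp id .inl
  · obtain ⟨x, hx⟩ := (hmem v hv).1.exists_adj_iff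
    rw [hx, (hx v).1 (hmem v hv).2.symm]

end Types

/-- For a graph all of whose internal vertices are of type 0 or 1,
`μ_α(G) ≤ 1` iff `μ_α(G₀) ≤ 1` and every independent set `I ⊆ V(G₁)` with `|I| ≤ 2·n₀`
satisfies `α(G₀) − i(G₀ − N(I)) ≤ 1`. -/
theorem gap_le_one_iff_types01 {V : Type*} [Fintype V] (G : SimpleGraph V)
    (htypes : ∀ v : V, IsInternal G v → HasType G v 0 ∨ HasType G v 1)
    (n0 : ℕ) (hn0 : n0 = maxCompCard (G.induce (typeSet G 0))) :
    indepGap G ≤ 1 ↔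
      indepGap (G.induce (typeSet G 0)) ≤ 1 ∧
        ∀ I : Set V, IndepSet G I → I ⊆ typeSet G 1 → I.ncard ≤ 2 * n0 →
          alphaNum (G.induce (typeSet G 0)) -
            iNum (G.induce (typeSet G 0 \ nbhd G I)) ≤ 1 := by
  obtain ⟨f, hf⟩ := exists_pendantPartition htypes
  rw [hf.indepGap_le_iff]
  constructor
  · refine fun h => ⟨?_, fun I hI hIB _ => h I hI hIB⟩
    have hempty := h ∅ (fun _ ha => ha.elim) (Set.empty_subset _)
    rwa [nbhd_empty, Set.sdiff_empty] at hempty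
  · rintro ⟨-, h⟩ I hI hIB
    by_contra hgap
    obtain ⟨J, hJI, hJcard, hJ⟩ := exists_ncard_le_of_iNum_add_two_le (G := G)
      (A := typeSet G 0) (I := I) (by omega)
    have := h J (hI.mono hJI) (hJI.trans hIB) (hn0 ▸ hJcard)
    omega
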